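/- (i) Let s ∈ ℕ^{<ω} and for each n ∈ ℕ let Bₙ be an infinite subset of 𝒩_{s⌢n}. Then I_wf↾(∪ₙ Bₙ) ≅ ⊕ₙ (I_wf↾Bₙ). (ii) Let θ ∈ ℕ^ω, let sₙ be the finite sequence (θ(0),…,θ(n−1),θ(n)+1), and for each n let Bₙ be an infinite subset of 𝒩_{sₙ}. Then I_wf↾(∪ₙ Bₙ) ≅ (⊕ₙ (I_d↾Bₙ))⊥. -/

import Mathlib

open Set

/-- The orthogonal of a family of sets: all sets having finite intersection
with every member of the family. -/
def orth {X : Type*} (I : Set (Set X)) : Set (Set X) :=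
  {B | ∀ A ∈ I, (A ∩ B).Finite}

/-- `I` is an ideal on `X`: contains `∅`, closed under subsets and finite unions
(the improper ideal `𝒫 X` is allowed). -/
def IsIdealOn {X : Type*} (I : Set (Set X)) : Prop :=
  ∅ ∈ I ∧ (∀ A ∈ I, ∀ B ⊆ A, B ∈ I) ∧ (∀ A ∈ I, ∀ B ∈ I, A ∪ B ∈ I)

/-- An ideal is Fréchet if it equals its double orthogonal. -/
def IsFrechet {X : Type*} (I : Set (Set X)) : Prop := orth (orth I) = I

/-- Isomorphism of ideals: a bijection of the underlying sets such that
`A ∈ I ↔ f '' A ∈ J`. -/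
def IdealIso {X Y : Type*} (I : Set (Set X)) (J : Set (Set Y)) : Prop :=
  ∃ f : X ≃ Y, ∀ A : Set X, A ∈ I ↔ f '' A ∈ J

/-- Isomorphic embedding of ideals: an injection of the underlying sets such that
`A ∈ I ↔ f '' A ∈ J`. -/
def IdealEmbeds {X Y : Type*} (I : Set (Set X)) (J : Set (Set Y)) : Prop :=
  ∃ f : X → Y, Function.Injective f ∧ ∀ A : Set X, A ∈ I ↔ f '' A ∈ J

/-- The restriction `I ↾ K` of an ideal on `X` to a subset `K ⊆ X`,
viewed as an ideal on the subtype `↥K`. -/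
def restrictIdeal {X : Type*} (I : Set (Set X)) (K : Set X) : Set (Set ↥K) :=
  {A | (Subtype.val '' A : Set X) ∈ I}

/-- `FIN`, the ideal of finite subsets of `ℕ`. -/
def finIdeal : Set (Set ℕ) := {A | A.Finite}

/-- Countable direct sum of ideals on `ℕ`, realized on `ℕ` via the pairing
bijection `ℕ × ℕ ≃ ℕ`: the `n`-th block is `{Nat.pair n m : m ∈ ℕ}`. -/
def directSumN (I : ℕ → Set (Set ℕ)) : Set (Set ℕ) :=
  {A | ∀ n, {m | Nat.pair n m ∈ A} ∈ I n}

/-- Finite direct sum `I 0 ⊕ ⋯ ⊕ I k` of ideals on `ℕ`, realized on `ℕ` using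
the partition of `ℕ` into residue classes mod `k + 1`. -/
def finSumN (k : ℕ) (I : ℕ → Set (Set ℕ)) : Set (Set ℕ) :=
  {A | ∀ i ≤ k, {m | m * (k + 1) + i ∈ A} ∈ I i}

/-- Binary direct sum of ideals on `ℕ`, realized on `ℕ` via evens and odds. -/
def sum2 (I J : Set (Set ℕ)) : Set (Set ℕ) :=
  {A | {m | 2 * m ∈ A} ∈ I ∧ {m | 2 * m + 1 ∈ A} ∈ J}

/-- All countable direct sums of members of `U`. -/
def sumsOf (U : Set (Set (Set ℕ))) : Set (Set (Set ℕ)) :=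
  {J | ∃ I : ℕ → Set (Set ℕ), (∀ n, I n ∈ U) ∧ J = directSumN I}

/-- `ℬ_α^{⊕⊥}`: countable direct sums of members of `U` together with their
orthogonals. -/
def sumsPerpOf (U : Set (Set (Set ℕ))) : Set (Set (Set ℕ)) :=
  sumsOf U ∪ {J | ∃ I ∈ sumsOf U, J = orth I}

/-- `ℬ_α`: finite direct sums of members of `ℬ_α^{⊕⊥}`. -/
def BstepOf (U : Set (Set (Set ℕ))) : Set (Set (Set ℕ)) :=
  {J | ∃ k, ∃ I : ℕ → Set (Set ℕ), (∀ i ≤ k, I i ∈ sumsPerpOf U) ∧ J = finSumN k I}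

/-- The hierarchy `ℬ_α`: `ℬ₀ = {𝒫(ℕ), FIN, 𝒫(ℕ) ⊕ FIN}` and, for `α > 0`,
`ℬ_α` consists of the finite direct sums of countable direct sums of members of
`⋃_{ξ<α} ℬ_ξ` and of orthogonals of such countable sums. -/
noncomputable def Bfam : Ordinal.{0} → Set (Set (Set ℕ)) :=
  WellFounded.fix wellFounded_lt fun α ih =>
    if α = 0 then {(Set.univ : Set (Set ℕ)), finIdeal, sum2 Set.univ finIdeal}
    else BstepOf {I | ∃ ξ, ∃ h : ξ < α, I ∈ ih ξ h}

/-- The first uncountable ordinal `ω₁`. -/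
noncomputable def omega1 : Ordinal.{0} := (Cardinal.aleph 1).ord

/-- An ideal (on any countable set) belongs to `ℬ = ⋃_{α<ω₁} ℬ_α`
(membership in `ℬ` is understood up to isomorphism). -/
def InB {X : Type*} (I : Set (Set X)) : Prop :=
  ∃ α, α < omega1 ∧ ∃ J ∈ Bfam α, IdealIso I J

/-- The ideals `P_α`: `P₀ = 𝒫(ℕ)`, `P_{α+1} = (P_α⊥)^ω`, and for limit `α`,
`P_α = ⊕ₙ P_{v α n}⊥` where `v α` is a fixed increasing sequence with supremum `α`. -/
noncomputable def Pfam (v : Ordinal.{0} → ℕ → Ordinal.{0}) : Ordinal.{0} → Set (Set ℕ) :=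
  fun α => @Ordinal.limitRecOn (fun _ => Set (Set ℕ)) α
    (Set.univ : Set (Set ℕ))
    (fun _ P => directSumN fun _ => orth P)
    (fun β _ ih => directSumN fun n =>
      if h : v β n < β then orth (ih (v β n) h) else ∅)

/-- The subset of the Cantor cube `2^X` corresponding to a family of subsets of `X`. -/
def idealSet {X : Type*} (I : Set (Set X)) : Set (X → Bool) := {f | {x | f x = true} ∈ I}

/-- An ideal is Borel if the corresponding subset of the Cantor cube `2^X` is Borel. -/
def IsBorelIdeal {X : Type*} (I : Set (Set X)) : Prop := MeasurableSet (idealSet I)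

/-- A subset of the Cantor cube is `F_σδ` if it is a countable intersection of
countable unions of closed sets. -/
def IsFsd {X : Type*} (S : Set (X → Bool)) : Prop :=
  ∃ C : ℕ → ℕ → Set (X → Bool), (∀ n m, IsClosed (C n m)) ∧ S = ⋂ n, ⋃ m, C n m

/-- The tree `⟨A⟩` generated by `A ⊆ ℕ^{<ω}`: all prefixes of members of `A`. -/
def genTree (A : Set (List ℕ)) : Set (List ℕ) := {t | ∃ a ∈ A, t <+: a}

/-- The ideal `I_wf` on `ℕ^{<ω}` of well founded sets: those `A` such that no
`α ∈ ℕ^ω` has all of its finite initial segments in `⟨A⟩`. -/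
def Iwf : Set (Set (List ℕ)) :=
  {A | ¬ ∃ α : ℕ → ℕ, ∀ n, (List.ofFn fun i : Fin n => α i) ∈ genTree A}

/-- The ideal `I_d = I_wf⊥` on `ℕ^{<ω}` of sets dominated by a branch. -/
def Idom : Set (Set (List ℕ)) :=
  {A | ∃ α : ℕ → ℕ, ∀ s ∈ A, ∀ i : Fin s.length, s.get i ≤ α i.1}

/-- `𝒩_t`, the set of extensions of `t` in `ℕ^{<ω}`. -/
def Nbhd (t : List ℕ) : Set (List ℕ) := {s | t <+: s}

/-- Direct sum of a sequence of ideals `I n` on sets `X n`, as an ideal on the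
disjoint union `Σ n, X n` (the partition into the fibers). -/
def sigmaSum {X : ℕ → Type*} (I : ∀ n, Set (Set (X n))) : Set (Set (Σ n, X n)) :=
  {A | ∀ n, {x | (⟨n, x⟩ : Σ n, X n) ∈ A} ∈ I n}

/-- Binary direct sum of ideals on `X` and `Y`, as an ideal on `X ⊕ Y`. -/
def sumIdeal2 {X Y : Type*} (I : Set (Set X)) (J : Set (Set Y)) : Set (Set (X ⊕ Y)) :=
  {A | (Sum.inl ⁻¹' A) ∈ I ∧ (Sum.inr ⁻¹' A) ∈ J}

/-- A tree on `ℕ`: a subset of `ℕ^{<ω}` downward closed under the prefix order. -/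
def IsTree (T : Set (List ℕ)) : Prop := ∀ s ∈ T, ∀ t, t <+: s → t ∈ T

/-- `A_a = {s ∈ A : a ≼ s}`. -/
def subAt (A : Set (List ℕ)) (a : List ℕ) : Set (List ℕ) := {s ∈ A | a <+: s}

/-- The derivative `A' = {a ∈ A : A_a ∉ I_d}`. -/
def derivD (A : Set (List ℕ)) : Set (List ℕ) := {a ∈ A | subAt A a ∉ Idom}

/-- The iterated derivative `A^{(α)}`. -/
noncomputable def derivIter (A : Set (List ℕ)) : Ordinal.{0} → Set (List ℕ) :=
  fun α => @Ordinal.limitRecOn (fun _ => Set (List ℕ)) α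
    A (fun _ S => derivD S) (fun β _ ih => ⋂ ξ, ⋂ h : ξ < β, ih ξ h)

/-- The rank of `A`: the least `α` with `A^{(α)} = A^{(α+1)}`. -/
noncomputable def rkD (A : Set (List ℕ)) : Ordinal.{0} :=
  sInf {α | derivIter A α = derivIter A (α + 1)}

/-- The ideal `WO(ℚ)` of well ordered (equivalently, well founded) subsets of `ℚ`. -/
def WOideal : Set (Set ℚ) := {A | A.IsWF}

/-- A subset of `ℚ` is scattered if `ℚ` does not order-embed into it. -/
def Scattered (A : Set ℚ) : Prop := ¬ ∃ f : ℚ → ℚ, (∀ q, f q ∈ A) ∧ StrictMono f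

/-- The dual filter of an ideal on `ℕ`. -/
def dualFilter (I : Set (Set ℕ)) : Set (Set ℕ) := {A | Aᶜ ∈ I}

/-- `U` is open in the topology `τ_F` on `ℕ^{<ω}` determined by the filter `F`. -/
def isTauOpen (F : Set (Set ℕ)) (U : Set (List ℕ)) : Prop :=
  ∀ s ∈ U, {n | s ++ [n] ∈ U} ∈ F

theorem genTree_mono {A C : Set (List ℕ)} (h : A ⊆ C) : genTree A ⊆ genTree C :=
  fun _ ⟨a, ha, hp⟩ => ⟨a, h ha, hp⟩

theorem Iwf_mono {A C : Set (List ℕ)} (h : A ⊆ C) (hC : C ∈ Iwf) : A ∈ Iwf :=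
  fun ⟨α, hα⟩ => hC ⟨α, fun n => genTree_mono h (hα n)⟩

theorem ofFn_prefix_iff (α : ℕ → ℕ) (n : ℕ) (a : List ℕ) :
    (List.ofFn fun i : Fin n => α i) <+: a ↔ ∀ i < n, a[i]? = some (α i) := by
  rw [List.prefix_iff_getElem?]
  simp

theorem mem_Idom_iff {A : Set (List ℕ)} :
    A ∈ Idom ↔ ∃ α : ℕ → ℕ, ∀ s ∈ A, ∀ i x, s[i]? = some x → x ≤ α i := by
  refine exists_congr fun α => forall₂_congr fun s _ => ⟨fun h i x hx => ?_, fun h i => ?_⟩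
  · obtain ⟨hi, rfl⟩ := List.getElem?_eq_some_iff.1 hx
    exact h ⟨i, hi⟩
  · exact h i _ (by simp)

theorem Idom_mono {A C : Set (List ℕ)} (h : A ⊆ C) (hC : C ∈ Idom) : A ∈ Idom :=
  let ⟨α, hα⟩ := hC
  ⟨α, fun s hs => hα s (h hs)⟩

/-- A dominated set with infinitely many members extending `t` has infinitely many members
extending some immediate successor of `t`. -/
theorem exists_infinite_subAt_append {A : Set (List ℕ)} (hA : A ∈ Idom) {t : List ℕ}
    (ht : (subAt A t).Infinite) : ∃ n, (subAt A (t ++ [n])).Infinite := by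
  obtain ⟨α, hα⟩ := mem_Idom_iff.1 hA
  by_contra! hfin
  refine ht (((finite_singleton t).union
    ((finite_Iic (α t.length)).biUnion fun n _ => hfin n)).subset ?_)
  rintro a ⟨ha, u, rfl⟩
  cases u with
  | nil => left; simp
  | cons n u =>
    right
    refine mem_biUnion (x := n) (hα _ ha _ _ (by simp)) ⟨ha, u, by simp⟩

/-- König's lemma: an infinite dominated set generates a tree with an infinite branch. -/
theorem notMem_Iwf_of_infinite {A : Set (List ℕ)} (hA : A ∈ Idom) (hinf : A.Infinite) :
    A ∉ Iwf := by
  choose c hc using fun t : {t // (subAt A t).Infinite} =>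
    exists_infinite_subAt_append hA t.2
  let g : ℕ → {t // (subAt A t).Infinite} := fun k =>
    Nat.rec ⟨[], by simpa [subAt] using hinf⟩ (fun _ t => ⟨t.1 ++ [c t], hc t⟩) k
  have hg : ∀ k, (List.ofFn fun i : Fin k => c (g i)) = (g k).1 := by
    intro k
    induction k with
    | zero => simp [g]
    | succ k ih =>
      rw [List.ofFn_succ_last]
      simp only [Fin.val_castSucc, Fin.val_last, ih]
      rfl
  refine not_not_intro ⟨fun k => c (g k), fun k => ?_⟩
  obtain ⟨a, ha, hp⟩ := (g k).2.nonempty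
  exact ⟨a, ha, by rwa [hg k]⟩

theorem orth_Idom : orth Idom = Iwf := by
  ext A
  constructor
  · rintro hA ⟨α, hα⟩
    choose a ha hp using hα
    simp only [ofFn_prefix_iff] at hp
    have hdom : range a ∈ Idom := by
      refine mem_Idom_iff.2
        ⟨fun i => α i + ∑ k ∈ Finset.range (i + 1), ((a k)[i]?).getD 0, ?_⟩
      rintro _ ⟨k, rfl⟩ i x hx
      beta_reduce
      by_cases hk : i < k
      · have := (hp k i hk).symm.trans hx
        simp only [Option.some.injEq] at this
        omega
      · have := Finset.single_le_sum (f := fun k => ((a k)[i]?).getD 0)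
          (fun _ _ => Nat.zero_le _) (Finset.mem_range.2 (show k < i + 1 by omega))
        simp only [hx, Option.getD_some] at this
        omega
    have hfin := hA _ hdom
    rw [inter_eq_left.2 (range_subset_iff.2 ha)] at hfin
    obtain ⟨N, hN⟩ := (hfin.image List.length).bddAbove
    have hle : (a (N + 1)).length ≤ N := hN ⟨_, ⟨_, rfl⟩, rfl⟩
    have := hp (N + 1) N (by omega)
    rw [List.getElem?_eq_none hle] at this
    simp at this
  · intro hA C hC
    by_contra hinf
    exact notMem_Iwf_of_infinite (Idom_mono inter_subset_left hC) hinf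
      (Iwf_mono inter_subset_right hA)

theorem orth_restrictIdeal {X : Type*} {I : Set (Set X)}
    (hI : ∀ A C : Set X, A ⊆ C → C ∈ I → A ∈ I) (K : Set X) :
    orth (restrictIdeal I K) = restrictIdeal (orth I) K := by
  ext A
  constructor
  · intro hA C hC
    have hfin := (hA (Subtype.val ⁻¹' C)
      (hI _ C (image_preimage_subset _ _) hC)).image Subtype.val
    refine hfin.subset ?_
    rintro _ ⟨hx, y, hy, rfl⟩
    exact ⟨y, ⟨hx, hy⟩, rfl⟩
  · intro hA C hC
    have hfin := hA _ hC
    rw [← image_inter Subtype.val_injective] at hfin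
    exact hfin.of_finite_image Subtype.val_injective.injOn

theorem IdealIso.orth {X Y : Type*} {I : Set (Set X)} {J : Set (Set Y)} (h : IdealIso I J) :
    IdealIso (orth I) (orth J) := by
  obtain ⟨f, hf⟩ := h
  refine ⟨f, fun A => ⟨fun hA C hC => ?_, fun hA C hC => ?_⟩⟩
  · have hC' : f '' (f ⁻¹' C) = C := image_preimage_eq C f.surjective
    rw [← hC', ← image_inter f.injective]
    exact (hA _ ((hf _).2 (by rwa [hC']))).image f
  · have hfin := hA _ ((hf C).1 hC)
    rw [← image_inter f.injective] at hfin
    exact hfin.of_finite_image f.injective.injOn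

/-- If membership in `I` of subsets of a disjoint union is decided blockwise by `J`, then the
restriction of `I` is the direct sum of the restrictions of `J`. -/
theorem idealIso_sigmaSum {X : Type*} {I J : Set (Set X)} {B : ℕ → Set X}
    (hB : Pairwise (Function.onFun Disjoint B))
    (h : ∀ A ⊆ ⋃ n, B n, A ∈ I ↔ ∀ n, A ∩ B n ∈ J) :
    IdealIso (restrictIdeal I (⋃ n, B n)) (sigmaSum fun n => restrictIdeal J (B n)) := by
  refine ⟨Set.unionEqSigmaOfDisjoint hB, fun A => ?_⟩
  refine (h (Subtype.val '' A) (Subtype.coe_image_subset _ _)).trans (forall_congr' fun n => ?_)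
  have : Subtype.val '' A ∩ B n = Subtype.val ''
      {x : B n | (⟨n, x⟩ : Σ n, B n) ∈ Set.unionEqSigmaOfDisjoint hB '' A} := by
    ext x
    simp only [Equiv.image_eq_preimage_symm, mem_inter_iff, mem_image, mem_ofPred_eq,
      mem_preimage]
    constructor
    · rintro ⟨⟨y, hy, rfl⟩, hx⟩
      exact ⟨⟨y, hx⟩, hy, rfl⟩
    · rintro ⟨y, hy, rfl⟩
      exact ⟨⟨_, hy, rfl⟩, y.2⟩
  rw [this]
  rfl

theorem getElem?_of_mem_Nbhd_append {s a : List ℕ} {n : ℕ} (h : a ∈ Nbhd (s ++ [n])) :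
    a[s.length]? = some n := by
  obtain ⟨u, rfl⟩ := h
  simp

theorem pairwise_disjoint_of_subset_Nbhd_append {s : List ℕ} {B : ℕ → Set (List ℕ)}
    (hB : ∀ n, B n ⊆ Nbhd (s ++ [n])) : Pairwise (Function.onFun Disjoint B) := by
  refine fun n m hnm => Set.disjoint_left.2 fun a ha hb => hnm ?_
  simpa using (getElem?_of_mem_Nbhd_append (hB n ha)).symm.trans
    (getElem?_of_mem_Nbhd_append (hB m hb))

theorem mem_Iwf_iff_of_subset_Nbhd_append {s : List ℕ} {B : ℕ → Set (List ℕ)}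
    (hB : ∀ n, B n ⊆ Nbhd (s ++ [n])) {A : Set (List ℕ)} (hA : A ⊆ ⋃ n, B n) :
    A ∈ Iwf ↔ ∀ n, A ∩ B n ∈ Iwf := by
  refine ⟨fun h n => Iwf_mono inter_subset_left h, ?_⟩
  rintro h ⟨α, hα⟩
  refine h (α s.length) ⟨α, fun k => ?_⟩
  obtain ⟨a, ha, hp⟩ := hα (max k (s.length + 1))
  rw [ofFn_prefix_iff] at hp
  obtain ⟨n, hn⟩ := mem_iUnion.1 (hA ha)
  have heq := (hp s.length (by omega)).symm.trans (getElem?_of_mem_Nbhd_append (hB n hn))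
  obtain rfl : α s.length = n := by simpa using heq
  exact ⟨a, ⟨ha, hn⟩, (ofFn_prefix_iff _ _ _).2 fun i hi => hp i (by omega)⟩

theorem getElem?_of_mem_Nbhd_ofFn_append {θ : ℕ → ℕ} {n : ℕ} {a : List ℕ}
    (h : a ∈ Nbhd ((List.ofFn fun i : Fin n => θ i) ++ [θ n + 1])) :
    (∀ i < n, a[i]? = some (θ i)) ∧ a[n]? = some (θ n + 1) := by
  refine ⟨(ofFn_prefix_iff θ n a).1 ((List.prefix_append _ _).trans h), ?_⟩
  simpa using getElem?_of_mem_Nbhd_append h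

theorem pairwise_disjoint_of_subset_Nbhd_ofFn_append {θ : ℕ → ℕ} {B : ℕ → Set (List ℕ)}
    (hB : ∀ n, B n ⊆ Nbhd ((List.ofFn fun i : Fin n => θ i) ++ [θ n + 1])) :
    Pairwise (Function.onFun Disjoint B) := by
  refine (pairwise_disjoint_on B).2 fun n m hnm => Set.disjoint_left.2 fun a ha hb => ?_
  simpa using (getElem?_of_mem_Nbhd_ofFn_append (hB n ha)).2.symm.trans
    ((getElem?_of_mem_Nbhd_ofFn_append (hB m hb)).1 n hnm)

theorem mem_Idom_iff_of_subset_Nbhd_ofFn_append {θ : ℕ → ℕ} {B : ℕ → Set (List ℕ)}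
    (hB : ∀ n, B n ⊆ Nbhd ((List.ofFn fun i : Fin n => θ i) ++ [θ n + 1]))
    {A : Set (List ℕ)} (hA : A ⊆ ⋃ n, B n) :
    A ∈ Idom ↔ ∀ n, A ∩ B n ∈ Idom := by
  refine ⟨fun h n => Idom_mono inter_subset_left h, fun h => ?_⟩
  simp only [mem_Idom_iff] at h
  choose α hα using h
  refine mem_Idom_iff.2 ⟨fun i => θ i + 1 + ∑ n ∈ Finset.range i, α n i, ?_⟩
  intro a ha i x hx
  beta_reduce
  obtain ⟨n, hn⟩ := mem_iUnion.1 (hA ha)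
  obtain ⟨hlt, heq⟩ := getElem?_of_mem_Nbhd_ofFn_append (hB n hn)
  rcases lt_trichotomy i n with hi | rfl | hi
  · have := (hlt i hi).symm.trans hx
    simp only [Option.some.injEq] at this
    omega
  · have := heq.symm.trans hx
    simp only [Option.some.injEq] at this
    omega
  · have hle := Finset.single_le_sum (f := fun n => α n i)
      (fun _ _ => Nat.zero_le _) (Finset.mem_range.2 hi)
    have := hα n a ⟨ha, hn⟩ i x hx
    omega

/-- Lemma 4.2: (i) if `Bₙ ⊆ 𝒩_{s⌢n}` are infinite, then
`I_wf ↾ (⋃ₙ Bₙ) ≅ ⊕ₙ (I_wf ↾ Bₙ)`;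
(ii) if `θ ∈ ℕ^ω`, `sₙ = θ↾n ⌢ (θ(n)+1)` and `Bₙ ⊆ 𝒩_{sₙ}` are infinite, then
`I_wf ↾ (⋃ₙ Bₙ) ≅ (⊕ₙ (I_d ↾ Bₙ))⊥`. -/
theorem stmt9 :
    (∀ (s : List ℕ) (B : ℕ → Set (List ℕ)),
      (∀ n, (B n).Infinite) → (∀ n, B n ⊆ Nbhd (s ++ [n])) →
      IdealIso (restrictIdeal Iwf (⋃ n, B n))
        (sigmaSum fun n => restrictIdeal Iwf (B n))) ∧
    (∀ (θ : ℕ → ℕ) (B : ℕ → Set (List ℕ)),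
      (∀ n, (B n).Infinite) →
      (∀ n, B n ⊆ Nbhd ((List.ofFn fun i : Fin n => θ i) ++ [θ n + 1])) →
      IdealIso (restrictIdeal Iwf (⋃ n, B n))
        (orth (sigmaSum fun n => restrictIdeal Idom (B n)))) := by
  refine ⟨fun s B _ hB => ?_, fun θ B _ hB => ?_⟩
  · exact idealIso_sigmaSum (pairwise_disjoint_of_subset_Nbhd_append hB)
      fun A hA => mem_Iwf_iff_of_subset_Nbhd_append hB hA
  · rw [← orth_Idom, ← orth_restrictIdeal fun _ _ => Idom_mono]
    exact (idealIso_sigmaSum (pairwise_disjoint_of_subset_Nbhd_ofFn_append hB)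
      fun A hA => mem_Idom_iff_of_subset_Nbhd_ofFn_append hB hA).orth
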